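/- Suppose X = {X₁,…,X_m} is η-coplanar and Y = {Y₁,…,Y_{m'}} is η'-coplanar, they generate the same cone C_X = C_Y, and they define the same directional growth function γ_X = γ_Y. Then η = c·η' for some c > 0, and there exist integers n, n' ≥ 1 such that the n-th iteration X^(n) is a permutation of the n'-th iteration Y^(n') (the corresponding multisets coincide). -/

import Mathlib

open scoped BigOperators RealInnerProductSpace
open Filter Topology

noncomputable section

/-- `Euc s` is the Euclidean space `ℝ^s`. -/
abbrev Euc (s : ℕ) := EuclideanSpace ℝ (Fin s)

/-- The additive semigroup `X₁ℕ + ⋯ + X_mℕ` generated by the vectors `X j`. -/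
def sgOf {s : ℕ} {ι : Type*} [Fintype ι] (X : ι → Euc s) : Set (Euc s) :=
  {z | ∃ u : ι → ℕ, ∑ j, (u j : ℝ) • X j = z}

/-- The lattice `X₁ℤ + ⋯ + X_mℤ` generated by the vectors `X j`. -/
def latOf {s : ℕ} {ι : Type*} [Fintype ι] (X : ι → Euc s) : Set (Euc s) :=
  {z | ∃ u : ι → ℤ, ∑ j, (u j : ℝ) • X j = z}

/-- The convex cone `X₁ℝ⁺ + ⋯ + X_mℝ⁺` generated by the vectors `X j`. -/
def coneOf {s : ℕ} {ι : Type*} [Fintype ι] (X : ι → Euc s) : Set (Euc s) :=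
  {x | ∃ c : ι → ℝ, (∀ j, 0 ≤ c j) ∧ ∑ j, c j • X j = x}

/-- The multiplicity of `z`: the number of finite words `i₁…i_n` with
`X_{i₁} + ⋯ + X_{i_n} = z`. -/
def mult {s : ℕ} {ι : Type*} [Fintype ι] (X : ι → Euc s) (z : Euc s) : ℕ :=
  Set.ncard {w : List ι | (w.map X).sum = z}

/-- The multiplicity extended to the cone: the minimum of `mult X z` over points
`z` of the semigroup nearest to `x`. -/
def multC {s : ℕ} {ι : Type*} [Fintype ι] (X : ι → Euc s) (x : Euc s) : ℕ :=
  sInf {n | ∃ z ∈ sgOf X, dist x z = Metric.infDist x (sgOf X) ∧ mult X z = n}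

/-- All the vectors `X j` have integer coordinates. -/
def IntegralVecs {s : ℕ} {ι : Type*} (X : ι → Euc s) : Prop :=
  ∀ j i, ∃ n : ℤ, X j i = (n : ℝ)

/-- The entropy `h(p) = -∑ p_j log p_j` of a probability vector. -/
def entropy {m : ℕ} (p : Fin m → ℝ) : ℝ := -∑ j, p j * Real.log (p j)

/-- The `p`-th iteration of `X`: all sums `X_{ω₁} + ⋯ + X_{ω_p}` over words `ω`. -/
def iter {s m : ℕ} (X : Fin m → Euc s) (p : ℕ) : (Fin p → Fin m) → Euc s :=
  fun ω => ∑ i, X (ω i)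

/-- The exponential sum attached to the list `X`. -/
def PX {s m : ℕ} (X : Fin m → Euc s) (v : Euc s) : ℝ := ∑ j, Real.exp (-⟪v, X j⟫)

lemma PX_pow {s m : ℕ} (X : Fin m → Euc s) (v : Euc s) (N : ℕ) :
    PX X v ^ N = ∑ w : Fin N → Fin m, Real.exp (-⟪v, iter X N w⟫) := by
  unfold PX iter
  rw [Fintype.sum_pow]
  refine Finset.sum_congr rfl fun w _ => ?_
  rw [← Real.exp_sum, inner_sum, Finset.sum_neg_distrib]

lemma inner_iter {s m : ℕ} (X : Fin m → Euc s) (η : Euc s) (hη : ∀ j, ⟪η, X j⟫ = 1) (N : ℕ)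
    (w : Fin N → Fin m) : ⟪η, iter X N w⟫ = N := by
  simp [iter, inner_sum, hη]

lemma inner_sg {s m : ℕ} (X : Fin m → Euc s) (η : Euc s) (hη : ∀ j, ⟪η, X j⟫ = 1)
    (u : Fin m → ℕ) : ⟪η, ∑ j, (u j : ℝ) • X j⟫ = ((∑ j, u j : ℕ) : ℝ) := by
  simp [inner_sum, inner_smul_right, hη]

lemma mult_eq {s m : ℕ} (X : Fin m → Euc s) (η : Euc s) (hη : ∀ j, ⟪η, X j⟫ = 1) (N : ℕ)
    (z : Euc s) (hz : ⟪η, z⟫ = N) :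
    mult X z = Set.ncard {w : Fin N → Fin m | iter X N w = z} := by
  unfold mult
  rw [← Set.ncard_image_of_injective (f := List.ofFn) _ List.ofFn_injective]
  congr 1
  ext l
  simp only [Set.mem_ofPred_eq, Set.mem_image]
  constructor
  · intro h
    have hl : l.length = N := by
      have : ⟪η, (l.map X).sum⟫ = l.length := by
        clear h
        induction l with
        | nil => simp
        | cons a t ih => simp [inner_add_right, ih, hη]; ring
      rw [h, hz] at this
      exact_mod_cast this.symm
    subst hl
    refine ⟨l.get, ?_, List.ofFn_get l⟩
    rw [← h]
    conv_rhs => rw [← List.ofFn_get l, List.map_ofFn, List.sum_ofFn]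
    rfl
  · rintro ⟨w, hw, rfl⟩
    rw [List.map_ofFn, List.sum_ofFn, ← hw]
    rfl

lemma mult_le {s m : ℕ} (X : Fin m → Euc s) (η : Euc s) (hη : ∀ j, ⟪η, X j⟫ = 1) (v : Euc s)
    (hv : PX X v ≤ 1) (z : Euc s) (hz : z ∈ sgOf X) : (mult X z : ℝ) ≤ Real.exp ⟪v, z⟫ := by
  classical
  obtain ⟨u, rfl⟩ := hz
  set N := ∑ j, u j
  set z := ∑ j, (u j : ℝ) • X j with hzdef
  have hz : ⟪η, z⟫ = N := inner_sg X η hη u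
  rw [mult_eq X η hη N z hz]
  have h0 : 0 ≤ PX X v := Finset.sum_nonneg fun j _ => (Real.exp_pos _).le
  have h1 : PX X v ^ N ≤ 1 := pow_le_one₀ h0 hv
  rw [PX_pow] at h1
  have h2 : ∑ w ∈ Finset.univ.filter (fun w : Fin N → Fin m => iter X N w = z),
      Real.exp (-⟪v, iter X N w⟫) ≤ 1 :=
    (Finset.sum_le_sum_of_subset_of_nonneg (Finset.filter_subset _ _)
      (fun _ _ _ => (Real.exp_pos _).le)).trans h1
  rw [Finset.sum_congr rfl (g := fun _ => Real.exp (-⟪v, z⟫))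
    (by intro w hw; rw [(Finset.mem_filter.1 hw).2])] at h2
  rw [Finset.sum_const, nsmul_eq_mul, Real.exp_neg] at h2
  have h3 : Set.ncard {w : Fin N → Fin m | iter X N w = z}
      = (Finset.univ.filter (fun w : Fin N → Fin m => iter X N w = z)).card := by
    rw [← Set.ncard_coe_finset]; simp
  rw [h3]
  have := Real.exp_pos ⟪v, z⟫
  rw [← div_eq_mul_inv, div_le_one this] at h2
  exact h2

lemma exists_word {m : ℕ} (u : Fin m → ℕ) :
    ∃ w : Fin (∑ j, u j) → Fin m, ∀ j, Fintype.card {i // w i = j} = u j := by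
  classical
  have e : Fin (∑ j, u j) ≃ (Σ j, Fin (u j)) := (Fintype.equivFinOfCardEq (by simp)).symm
  refine ⟨fun i => (e i).1, fun j => ?_⟩
  have h1 : {i // (e i).1 = j} ≃ {x : (Σ j, Fin (u j)) // x.1 = j} :=
    e.subtypeEquiv (fun _ => Iff.rfl)
  rw [Fintype.card_congr h1, Fintype.card_congr (Equiv.sigmaSubtype j)]
  simp

lemma mult_ge {s m : ℕ} (X : Fin m → Euc s) (η : Euc s) (hη : ∀ j, ⟪η, X j⟫ = 1)
    (u : Fin m → ℕ) :
    (∑ j, u j).factorial ≤ mult X (∑ j, (u j : ℝ) • X j) * ∏ j, (u j).factorial := by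
  classical
  obtain ⟨N, hN, w, hw⟩ : ∃ N, N = ∑ j, u j ∧ ∃ w : Fin N → Fin m,
      ∀ j, Fintype.card {i // w i = j} = u j := ⟨_, rfl, exists_word u⟩
  rw [mult_eq X η hη N _ (by rw [hN]; exact inner_sg X η hη u), ← hN]
  have hiter : iter X N w = ∑ j, (u j : ℝ) • X j := by
    unfold iter
    rw [← Finset.sum_fiberwise Finset.univ w]
    refine Finset.sum_congr rfl fun j _ => ?_
    rw [Finset.sum_congr rfl (g := fun _ => X j)
      (by intro i hi; rw [(Finset.mem_filter.1 hi).2]), Finset.sum_const, ← hw j,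
      Fintype.card_subtype, Nat.cast_smul_eq_nsmul]
  have h3 : Set.ncard {w : Fin N → Fin m | iter X N w = ∑ j, (u j : ℝ) • X j}
      = (Finset.univ.filter
        (fun w : Fin N → Fin m => iter X N w = ∑ j, (u j : ℝ) • X j)).card := by
    rw [← Set.ncard_coe_finset]; simp
  rw [h3, mul_comm]
  have hc : (Finset.univ : Finset (Equiv.Perm (Fin N))).card = N.factorial := by
    rw [Finset.card_univ, Fintype.card_perm, Fintype.card_fin]
  rw [← hc]
  refine Finset.card_le_mul_card_image_of_maps_to (f := fun σ : Equiv.Perm (Fin N) => w ∘ σ)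
    ?_ _ ?_
  · intro σ _
    simp only [Finset.mem_filter, Finset.mem_univ, true_and]
    rw [← hiter]
    exact Equiv.sum_comp σ (fun i => X (w i))
  · intro b _
    by_cases hb : ∃ τ : Equiv.Perm (Fin N), w ∘ τ = b
    · obtain ⟨τ, rfl⟩ := hb
      have := DomMulAct.stabilizer_card w
      simp only [hw] at this
      rw [← this, Fintype.card_subtype]
      refine Finset.card_le_card_of_injOn (fun σ => σ * τ⁻¹) ?_ ?_
      · intro σ hσ
        have hσ' : w ∘ σ = w ∘ τ := by simpa using hσ
        simp only [Finset.coe_filter, Finset.mem_univ, true_and, Set.mem_ofPred_eq]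
        funext i
        have := congrFun hσ' (τ⁻¹ i)
        simpa using this
      · intro a _ b _ h
        exact mul_right_cancel h
    · have : (Finset.univ.filter (fun σ : Equiv.Perm (Fin N) => w ∘ σ = b)) = ∅ := by
        ext σ
        simp only [Finset.mem_filter, Finset.mem_univ, true_and, Finset.notMem_empty, iff_false]
        exact fun h => hb ⟨σ, h⟩
      rw [this]; simp
lemma log_fact_ge (n : ℕ) (hn : 0 < n) :
    (n : ℝ) * Real.log n - n ≤ Real.log (n.factorial) := by
  have h := Real.pow_div_factorial_le_exp (x := (n : ℝ)) (by positivity) n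
  have hf : (0 : ℝ) < n.factorial := by positivity
  have hn' : (0 : ℝ) < n := by positivity
  have h2 := Real.log_le_log (by positivity) h
  rw [Real.log_exp, Real.log_div (by positivity) (by positivity), Real.log_pow] at h2
  linarith

lemma log_fact_le (n : ℕ) :
    Real.log (n.factorial) ≤ ((n : ℝ) + 1) * Real.log (n + 1) - n := by
  induction n with
  | zero => simp
  | succ n ih =>
    rw [Nat.factorial_succ]
    push_cast
    rw [Real.log_mul (by positivity) (by positivity)]
    have h1 : Real.log (((n : ℝ) + 1) / (n + 1 + 1)) ≤ ((n : ℝ) + 1) / (n + 1 + 1) - 1 :=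
      Real.log_le_sub_one_of_pos (by positivity)
    rw [Real.log_div (by positivity) (by positivity)] at h1
    have h2 : ((n : ℝ) + 1 + 1) * (((n : ℝ) + 1) / (n + 1 + 1) - 1) = -1 := by
      field_simp; ring
    have h3 := mul_le_mul_of_nonneg_left h1 (show (0 : ℝ) ≤ (n : ℝ) + 1 + 1 by positivity)
    rw [h2] at h3
    nlinarith

lemma log_div_nat_tendsto : Tendsto (fun k : ℕ => Real.log k / k) atTop (𝓝 0) := by
  have h := Real.isLittleO_log_id_atTop.tendsto_div_nhds_zero
  exact h.comp tendsto_natCast_atTop_atTop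

lemma fact_asymp (n : ℕ → ℕ) (r : ℝ) (hr : 0 < r)
    (h : Tendsto (fun k : ℕ => (n k : ℝ) / k) atTop (𝓝 r)) :
    Tendsto (fun k : ℕ => (Real.log ((n k).factorial) - n k * Real.log k) / k) atTop
      (𝓝 (r * Real.log r - r)) := by
  have hpos : ∀ᶠ k : ℕ in atTop, 0 < n k := by
    filter_upwards [h.eventually (lt_mem_nhds hr)] with k hk
    rcases Nat.eq_zero_or_pos (n k) with h0 | h0
    · simp [h0] at hk
    · exact h0
  have h1 : Tendsto (fun k : ℕ => ((n k : ℝ) + 1) / k) atTop (𝓝 r) := by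
    have := h.add (tendsto_one_div_atTop_nhds_zero_nat (𝕜 := ℝ))
    simpa [add_div] using this
  have hlow : Tendsto (fun k : ℕ => (n k : ℝ) / k * Real.log ((n k : ℝ) / k) - (n k : ℝ) / k)
      atTop (𝓝 (r * Real.log r - r)) :=
    (h.mul (h.log hr.ne')).sub h
  have hup : Tendsto (fun k : ℕ => ((n k : ℝ) + 1) / k * Real.log (((n k : ℝ) + 1) / k)
      + Real.log k / k - (n k : ℝ) / k) atTop (𝓝 (r * Real.log r + 0 - r)) :=
    ((h1.mul (h1.log hr.ne')).add log_div_nat_tendsto).sub h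
  rw [add_zero] at hup
  refine tendsto_of_tendsto_of_tendsto_of_le_of_le' hlow hup ?_ ?_
  · filter_upwards [hpos, eventually_gt_atTop 0] with k hk hk0
    have hk' : (0 : ℝ) < k := by exact_mod_cast hk0
    have hn' : (0 : ℝ) < n k := by exact_mod_cast hk
    rw [Real.log_div (by positivity) (by positivity)]
    have := log_fact_ge (n k) hk
    rw [le_div_iff₀ hk']
    have e : ((n k : ℝ) / k * (Real.log (n k) - Real.log k) - (n k : ℝ) / k) * k
      = n k * (Real.log (n k) - Real.log k) - n k := by field_simp
    rw [e]; linarith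
  · filter_upwards [hpos, eventually_gt_atTop 0] with k hk hk0
    have hk' : (0 : ℝ) < k := by exact_mod_cast hk0
    have hn' : (0 : ℝ) < n k := by exact_mod_cast hk
    rw [Real.log_div (by positivity) (by positivity)]
    have := log_fact_le (n k)
    rw [div_le_iff₀ hk']
    have e : (((n k : ℝ) + 1) / k * (Real.log (n k + 1) - Real.log k) + Real.log k / k
      - (n k : ℝ) / k) * k
      = (n k + 1) * (Real.log (n k + 1) - Real.log k) + Real.log k - n k := by field_simp
    rw [e]; linarith

lemma multinom_asymp {m : ℕ} (u : ℕ → Fin m → ℕ) (r : Fin m → ℝ) (hr : ∀ j, 0 < r j)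
    (hR : 0 < ∑ j, r j)
    (h : ∀ j, Tendsto (fun k : ℕ => (u k j : ℝ) / k) atTop (𝓝 (r j))) :
    Tendsto (fun k : ℕ => (Real.log ((∑ j, u k j).factorial)
      - ∑ j, Real.log ((u k j).factorial)) / k) atTop
      (𝓝 ((∑ j, r j) * Real.log (∑ j, r j) - ∑ j, r j * Real.log (r j))) := by
  have hN : Tendsto (fun k : ℕ => ((∑ j, u k j : ℕ) : ℝ) / k) atTop (𝓝 (∑ j, r j)) := by
    have := tendsto_finsetSum (Finset.univ : Finset (Fin m)) (fun j _ => h j)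
    refine this.congr fun k => ?_
    push_cast
    rw [Finset.sum_div]
  have h1 := fact_asymp (fun k => ∑ j, u k j) _ hR hN
  have h2 := tendsto_finsetSum (Finset.univ : Finset (Fin m))
    (fun j _ => fact_asymp (fun k => u k j) _ (hr j) (h j))
  have h3 := h1.sub h2
  have e : (∑ j, r j) * Real.log (∑ j, r j) - (∑ j, r j) - ∑ j, (r j * Real.log (r j) - r j)
     = (∑ j, r j) * Real.log (∑ j, r j) - ∑ j, r j * Real.log (r j) := by
    rw [Finset.sum_sub_distrib]; ring
  rw [e] at h3
  refine h3.congr fun k => ?_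
  rw [← Finset.sum_div, ← sub_div, Finset.sum_sub_distrib, ← Finset.sum_mul]
  push_cast
  ring

/-- Integral points. -/
def IntPts (s : ℕ) : Set (Euc s) := {z | ∀ i, ∃ n : ℤ, z i = (n : ℝ)}

lemma IntPts.finite_ball {s : ℕ} (R : ℝ) : (IntPts s ∩ {z | ‖z‖ ≤ R}).Finite := by
  have hfin : (Set.Icc (fun _ : Fin s => -⌈R⌉) (fun _ : Fin s => ⌈R⌉)).Finite := Set.finite_Icc _ _
  refine (hfin.image (fun f : Fin s → ℤ =>
    (WithLp.toLp 2 (fun i => (f i : ℝ)) : Euc s))).subset ?_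
  rintro z ⟨hz, hR⟩
  choose f hf using hz
  refine ⟨f, ⟨?_, ?_⟩, ?_⟩
  · intro i
    have h1 : ‖z i‖ ≤ ‖z‖ := PiLp.norm_apply_le z i
    have h2 : |(f i : ℝ)| ≤ R := by
      rw [← hf i]; exact h1.trans hR
    have h3 : ((-⌈R⌉ : ℤ) : ℝ) ≤ f i := by
      push_cast
      linarith [(abs_le.1 h2).1, Int.le_ceil R]
    exact_mod_cast h3
  · intro i
    have h1 : ‖z i‖ ≤ ‖z‖ := PiLp.norm_apply_le z i
    have h2 : |(f i : ℝ)| ≤ R := by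
      rw [← hf i]; exact h1.trans hR
    have h3 : (f i : ℝ) ≤ ((⌈R⌉ : ℤ) : ℝ) := by
      linarith [(abs_le.1 h2).2, Int.le_ceil R]
    exact_mod_cast h3
  · ext i
    simp [hf i]

lemma IntPts.sub_mem {s : ℕ} {x y : Euc s} (hx : x ∈ IntPts s) (hy : y ∈ IntPts s) :
    x - y ∈ IntPts s := by
  intro i
  obtain ⟨a, ha⟩ := hx i
  obtain ⟨b, hb⟩ := hy i
  exact ⟨a - b, by simp [ha, hb]⟩

lemma lat_int {s m : ℕ} (X : Fin m → Euc s) (hint : IntegralVecs X) (u : Fin m → ℤ) :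
    ∑ j, (u j : ℝ) • X j ∈ IntPts s := by
  intro i
  choose f hf using hint
  exact ⟨∑ j, u j * f j i, by simp [hf]⟩

lemma sg_subset {s m : ℕ} (X : Fin m → Euc s) (hint : IntegralVecs X) :
    sgOf X ⊆ IntPts s := by
  rintro _ ⟨u, rfl⟩
  simpa using lat_int X hint (fun j => (u j : ℤ))

lemma sg_closed {s m : ℕ} (X : Fin m → Euc s) (hint : IntegralVecs X) : IsClosed (sgOf X) := by
  refine Metric.isClosed_of_pairwise_le_dist (ε := 1) one_pos ?_
  intro x hx y hy hxy
  have hs := IntPts.sub_mem (sg_subset X hint hx) (sg_subset X hint hy)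
  rw [dist_eq_norm]
  have : ∃ i, (x - y) i ≠ 0 := by
    by_contra hcon
    push Not at hcon
    apply hxy
    rw [← sub_eq_zero]
    ext i
    simpa using hcon i
  obtain ⟨i, hi⟩ := this
  obtain ⟨n, hn⟩ := hs i
  refine le_trans ?_ (PiLp.norm_apply_le (x - y) i)
  rw [hn] at hi ⊢
  have : n ≠ 0 := by rintro rfl; simp at hi
  rw [Real.norm_eq_abs]
  exact_mod_cast Int.one_le_abs this

lemma near_floor {s m : ℕ} (X : Fin m → Euc s) (c : Fin m → ℝ) (hc : ∀ j, 0 ≤ c j) :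
    ‖∑ j, c j • X j - ∑ j, ((⌊c j⌋₊ : ℕ) : ℝ) • X j‖ ≤ ∑ j, ‖X j‖ := by
  rw [← Finset.sum_sub_distrib]
  refine (norm_sum_le _ _).trans (Finset.sum_le_sum fun j _ => ?_)
  rw [← sub_smul, norm_smul]
  have h1 := Nat.floor_le (hc j)
  have h2 := Nat.lt_floor_add_one (c j)
  have : ‖c j - (⌊c j⌋₊ : ℝ)‖ ≤ 1 := by
    rw [Real.norm_eq_abs, abs_le]; constructor <;> linarith
  nlinarith [norm_nonneg (X j)]

lemma multC_spec {s m : ℕ} (X : Fin m → Euc s) (hint : IntegralVecs X) (x : Euc s)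
    (hx : x ∈ coneOf X) :
    ∃ z ∈ sgOf X, dist x z ≤ ∑ j, ‖X j‖ ∧ mult X z = multC X x := by
  obtain ⟨c, hc, rfl⟩ := hx
  have hmem : (∑ j, ((⌊c j⌋₊ : ℕ) : ℝ) • X j) ∈ sgOf X := ⟨_, rfl⟩
  have hne : (sgOf X).Nonempty := ⟨_, hmem⟩
  obtain ⟨z0, hz0, hd0⟩ := (sg_closed X hint).exists_infDist_eq_dist hne (∑ j, c j • X j)
  have hS : {n | ∃ z ∈ sgOf X, dist (∑ j, c j • X j) z
      = Metric.infDist (∑ j, c j • X j) (sgOf X) ∧ mult X z = n}.Nonempty :=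
    ⟨_, z0, hz0, hd0.symm, rfl⟩
  obtain ⟨z, hz, hd, hm⟩ := Nat.sInf_mem hS
  refine ⟨z, hz, ?_, hm⟩
  rw [hd]
  refine (Metric.infDist_le_dist_of_mem hmem).trans ?_
  rw [dist_eq_norm]
  exact near_floor X c hc

lemma cone_smul {s m : ℕ} (X : Fin m → Euc s) (x : Euc s) (hx : x ∈ coneOf X) (t : ℝ)
    (ht : 0 ≤ t) : t • x ∈ coneOf X := by
  obtain ⟨c, hc, rfl⟩ := hx
  exact ⟨fun j => t * c j, fun j => mul_nonneg ht (hc j), by simp [Finset.smul_sum, mul_smul]⟩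

lemma gamma_le {s m : ℕ} (X : Fin m → Euc s) (hint : IntegralVecs X) (η : Euc s)
    (hη : ∀ j, ⟪η, X j⟫ = 1) (v : Euc s) (hv : PX X v ≤ 1) (θ : Euc s) (hθ : θ ∈ coneOf X)
    (g : ℝ) (hg : Tendsto (fun k : ℕ => Real.log (multC X ((k : ℝ) • θ)) / k) atTop (𝓝 g)) :
    g ≤ ⟪v, θ⟫ := by
  set R := ∑ j, ‖X j‖
  have hlim : Tendsto (fun k : ℕ => ⟪v, θ⟫ + (‖v‖ * R) / k) atTop (𝓝 (⟪v, θ⟫ + 0)) :=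
    tendsto_const_nhds.add (tendsto_const_div_atTop_nhds_zero_nat _)
  rw [add_zero] at hlim
  refine le_of_tendsto_of_tendsto hg hlim ?_
  filter_upwards [eventually_gt_atTop 0] with k hk
  have hk' : (0 : ℝ) < k := by exact_mod_cast hk
  obtain ⟨z, hz, hd, hm⟩ := multC_spec X hint _ (cone_smul X θ hθ k hk'.le)
  rw [← hm, div_le_iff₀ hk']
  have h1 := mult_le X η hη v hv z hz
  have hpos : 0 < mult X z := by
    obtain ⟨u, rfl⟩ := hz
    have := mult_ge X η hη u
    by_contra h0
    have h0' : mult X (∑ j, (u j : ℝ) • X j) = 0 := by omega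
    rw [h0', zero_mul] at this
    have := Nat.factorial_pos (∑ j, u j)
    omega
  have h2 : Real.log (mult X z) ≤ ⟪v, z⟫ := by
    rw [← Real.log_exp ⟪v, z⟫]
    exact Real.log_le_log (by exact_mod_cast hpos) h1
  have h3 : ⟪v, z⟫ = k * ⟪v, θ⟫ - ⟪v, (k : ℝ) • θ - z⟫ := by
    rw [inner_sub_right, inner_smul_right]; ring
  have h4 : |⟪v, (k : ℝ) • θ - z⟫| ≤ ‖v‖ * R := by
    refine (abs_real_inner_le_norm _ _).trans ?_
    rw [dist_eq_norm] at hd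
    exact mul_le_mul_of_nonneg_left hd (norm_nonneg _)
  have e : (⟪v, θ⟫ + ‖v‖ * R / k) * k = k * ⟪v, θ⟫ + ‖v‖ * R := by field_simp
  rw [e]
  linarith [(abs_le.1 h4).1]

lemma gamma_ge {s m : ℕ} (X : Fin m → Euc s) (hint : IntegralVecs X) (η : Euc s)
    (hη : ∀ j, ⟪η, X j⟫ = 1) (r : Fin m → ℝ) (hr : ∀ j, 0 < r j) (hR : 0 < ∑ j, r j)
    (g : ℝ) (hg : Tendsto (fun k : ℕ => Real.log (multC X ((k : ℝ) • ∑ j, r j • X j)) / k)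
      atTop (𝓝 g)) :
    (∑ j, r j) * Real.log (∑ j, r j) - ∑ j, r j * Real.log (r j) ≤ g := by
  classical
  set R := ∑ j, ‖X j‖
  set θ := ∑ j, r j • X j with hθdef
  have hθ : θ ∈ coneOf X := ⟨r, fun j => (hr j).le, rfl⟩
  have hz := fun k : ℕ => multC_spec X hint _ (cone_smul X θ hθ (k : ℝ) k.cast_nonneg)
  choose z hz hd hm using hz
  choose y hy using hz
  set fl : ℕ → Fin m → ℕ := fun k j => ⌊(k : ℝ) * r j⌋₊
  set D : ℕ → Euc s := fun k => z k - ∑ j, (fl k j : ℝ) • X j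
  have hDn : ∀ k, ‖D k‖ ≤ 2 * R := by
    intro k
    have h1 := near_floor X (fun j => (k : ℝ) * r j) (fun j => mul_nonneg k.cast_nonneg (hr j).le)
    have h2 : ∑ j, ((k : ℝ) * r j) • X j = (k : ℝ) • θ := by
      simp [hθdef, Finset.smul_sum, mul_smul]
    rw [h2] at h1
    have h3 := hd k
    rw [dist_eq_norm, ← norm_neg] at h3
    have h4 : D k = -((k : ℝ) • θ - z k) + ((k : ℝ) • θ - ∑ j, (fl k j : ℝ) • X j) := by
      simp only [D]; abel
    rw [h4]
    refine (norm_add_le _ _).trans ?_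
    linarith
  have hDe : ∀ k, D k = ∑ j, (((y k j : ℤ) - (fl k j : ℤ) : ℤ) : ℝ) • X j := by
    intro k
    simp only [D, ← hy k]
    rw [← Finset.sum_sub_distrib]
    refine Finset.sum_congr rfl fun j _ => ?_
    push_cast
    rw [sub_smul]
  have hex : ∀ d : Euc s, ∃ t : Fin m → ℤ, (∃ k, D k = d) → ∑ j, (t j : ℝ) • X j = d := by
    intro d
    by_cases h : ∃ k, D k = d
    · obtain ⟨k, rfl⟩ := h
      exact ⟨_, fun _ => (hDe k).symm⟩
    · exact ⟨0, fun h' => absurd h' h⟩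
  choose τ hτ using hex
  have hfin : (Set.range D).Finite := by
    refine (IntPts.finite_ball (s := s) (2 * R)).subset ?_
    rintro _ ⟨k, rfl⟩
    refine ⟨?_, hDn k⟩
    rw [hDe k]
    exact lat_int X hint _
  have hT : ∃ T : ℝ, ∀ k j, |(τ (D k) j : ℝ)| ≤ T := by
    obtain ⟨T, hT⟩ := (hfin.image (fun d => ∑ j, |(τ d j : ℝ)|)).bddAbove
    refine ⟨T, fun k j => ?_⟩
    refine le_trans ?_ (hT ⟨D k, ⟨k, rfl⟩, rfl⟩)
    exact Finset.single_le_sum (f := fun j => |(τ (D k) j : ℝ)|) (fun _ _ => abs_nonneg _)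
      (Finset.mem_univ j)
  obtain ⟨T, hT⟩ := hT
  have hw : ∀ j, Tendsto (fun k : ℕ => ((fl k j : ℝ) + τ (D k) j) / k) atTop (𝓝 (r j)) := by
    intro j
    have h1 : Tendsto (fun k : ℕ => r j - (1 + T) / k) atTop (𝓝 (r j - 0)) :=
      tendsto_const_nhds.sub (tendsto_const_div_atTop_nhds_zero_nat _)
    have h2 : Tendsto (fun k : ℕ => r j + T / k) atTop (𝓝 (r j + 0)) :=
      tendsto_const_nhds.add (tendsto_const_div_atTop_nhds_zero_nat _)
    rw [sub_zero] at h1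
    rw [add_zero] at h2
    refine tendsto_of_tendsto_of_tendsto_of_le_of_le' h1 h2 ?_ ?_
    all_goals
      filter_upwards [eventually_gt_atTop 0] with k hk
      have hk' : (0 : ℝ) < k := by exact_mod_cast hk
      have f1 : (fl k j : ℝ) ≤ k * r j := Nat.floor_le (mul_nonneg hk'.le (hr j).le)
      have f2 : (k : ℝ) * r j < fl k j + 1 := Nat.lt_floor_add_one _
      have f3 := abs_le.1 (hT k j)
    · rw [le_div_iff₀ hk']
      have e : (r j - (1 + T) / k) * k = k * r j - (1 + T) := by field_simp
      rw [e]; linarith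
    · rw [div_le_iff₀ hk']
      have e : (r j + T / k) * k = k * r j + T := by field_simp
      rw [e]; linarith
  set u : ℕ → Fin m → ℕ := fun k j => ((fl k j : ℤ) + τ (D k) j).toNat
  have hpos : ∀ᶠ k : ℕ in atTop, ∀ j, 0 ≤ (fl k j : ℤ) + τ (D k) j := by
    rw [eventually_all]
    intro j
    filter_upwards [(hw j).eventually (lt_mem_nhds (hr j)), eventually_gt_atTop 0] with k hk hk0
    have hk' : (0 : ℝ) < k := by exact_mod_cast hk0
    have := (div_pos_iff_of_pos_right hk').1 hk
    have h' : (0 : ℝ) < ((fl k j : ℤ) + τ (D k) j : ℤ) := by push_cast; exact this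
    exact (by exact_mod_cast h' : (0 : ℤ) < (fl k j : ℤ) + τ (D k) j).le
  have hucast : ∀ᶠ k : ℕ in atTop, ∀ j, (u k j : ℝ) = (fl k j : ℝ) + τ (D k) j := by
    filter_upwards [hpos] with k hk j
    have : ((u k j : ℤ) : ℝ) = (((fl k j : ℤ) + τ (D k) j : ℤ) : ℝ) := by
      rw [Int.toNat_of_nonneg (hk j)]
    push_cast at this
    exact this
  have hu : ∀ j, Tendsto (fun k : ℕ => (u k j : ℝ) / k) atTop (𝓝 (r j)) := by
    intro j
    refine (hw j).congr' ?_
    filter_upwards [hucast] with k hk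
    rw [hk j]
  refine le_of_tendsto_of_tendsto (multinom_asymp u r hr hR hu) hg ?_
  filter_upwards [hucast, eventually_gt_atTop 0] with k hk hk0
  have hk' : (0 : ℝ) < k := by exact_mod_cast hk0
  have hzk : ∑ j, (u k j : ℝ) • X j = z k := by
    have h1 := hτ (D k) ⟨k, rfl⟩
    have : ∑ j, (u k j : ℝ) • X j = ∑ j, (fl k j : ℝ) • X j + ∑ j, (τ (D k) j : ℝ) • X j := by
      rw [← Finset.sum_add_distrib]
      refine Finset.sum_congr rfl fun j _ => ?_
      rw [hk j, add_smul]
    rw [this, h1]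
    simp [D]
  have hge := mult_ge X η hη (u k)
  rw [hzk, hm k] at hge
  apply div_le_div_of_nonneg_right _ hk'.le
  have hge' : ((∑ j, u k j).factorial : ℝ)
      ≤ multC X ((k : ℝ) • θ) * ∏ j, ((u k j).factorial : ℝ) := by exact_mod_cast hge
  have hp : (0 : ℝ) < ∏ j, ((u k j).factorial : ℝ) :=
    Finset.prod_pos fun j _ => by positivity
  have hf : (0 : ℝ) < ((∑ j, u k j).factorial : ℝ) := by positivity
  have hc : (multC X ((k : ℝ) • θ) : ℝ) ≠ 0 := by
    intro h0; rw [h0, zero_mul] at hge'; linarith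
  have := Real.log_le_log hf hge'
  rw [Real.log_mul hc hp.ne', Real.log_prod (fun j _ => by positivity)] at this
  linarith
lemma cone_pos {s m : ℕ} (X : Fin m → Euc s) (η : Euc s) (hη : ∀ j, ⟪η, X j⟫ = 1) (θ : Euc s)
    (hθ : θ ∈ coneOf X) (h0 : θ ≠ 0) : 0 < ⟪η, θ⟫ := by
  obtain ⟨c, hc, rfl⟩ := hθ
  have e : ⟪η, ∑ j, c j • X j⟫ = ∑ j, c j := by simp [inner_sum, inner_smul_right, hη]
  rw [e]
  rcases (Finset.sum_nonneg fun j (_ : j ∈ Finset.univ) => hc j).lt_or_eq with h | h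
  · exact h
  · exfalso
    have := (Finset.sum_eq_zero_iff_of_nonneg (fun j _ => hc j)).1 h.symm
    apply h0
    exact Finset.sum_eq_zero fun j hj => by rw [this j hj, zero_smul]

lemma gamma_at {s m : ℕ} (X : Fin m → Euc s) (hint : IntegralVecs X) (η : Euc s)
    (hη : ∀ j, ⟪η, X j⟫ = 1) (v : Euc s) (hv : PX X v = 1) (γ : Euc s → ℝ)
    (hγX : ∀ θ ∈ coneOf X, ‖θ‖ = 1 →
      Filter.Tendsto (fun k : ℕ => Real.log (multC X ((k : ℝ) • θ)) / k)
        Filter.atTop (nhds (γ θ))) :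
    ∃ θ ∈ coneOf X, ‖θ‖ = 1 ∧ ⟪v, θ⟫ ≤ γ θ := by
  set p : Fin m → ℝ := fun j => Real.exp (-⟪v, X j⟫) with hp
  have hp1 : ∑ j, p j = 1 := hv
  set x := ∑ j, p j • X j with hx
  have hx0 : x ≠ 0 := by
    intro h
    have e : ⟪η, x⟫ = 1 := by
      rw [hx]; simp [inner_sum, inner_smul_right, hη, hp1]
    rw [h] at e
    simp at e
  have hn : 0 < ‖x‖ := norm_pos_iff.2 hx0
  set r : Fin m → ℝ := fun j => ‖x‖⁻¹ * p j with hr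
  have hrpos : ∀ j, 0 < r j := fun j => mul_pos (inv_pos.2 hn) (Real.exp_pos _)
  have hrs : ∑ j, r j = ‖x‖⁻¹ := by rw [hr, ← Finset.mul_sum, hp1, mul_one]
  have hθ : ∑ j, r j • X j = ‖x‖⁻¹ • x := by
    simp [hr, hx, Finset.smul_sum, mul_smul]
  have hmem : ∑ j, r j • X j ∈ coneOf X := ⟨r, fun j => (hrpos j).le, rfl⟩
  have hnorm : ‖∑ j, r j • X j‖ = 1 := by
    rw [hθ, norm_smul, norm_inv, norm_norm, inv_mul_cancel₀ hn.ne']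
  refine ⟨_, hmem, hnorm, ?_⟩
  have := gamma_ge X hint η hη r hrpos (by rw [hrs]; exact inv_pos.2 hn) _ (hγX _ hmem hnorm)
  refine le_trans (le_of_eq ?_) this
  have hl : ∀ j, r j * Real.log (r j) = r j * Real.log ‖x‖⁻¹ - r j * ⟪v, X j⟫ := by
    intro j
    have : Real.log (r j) = Real.log ‖x‖⁻¹ - ⟪v, X j⟫ := by
      rw [hr]
      simp only
      rw [Real.log_mul (inv_pos.2 hn).ne' (Real.exp_pos _).ne', Real.log_exp]
      ring
    rw [this]; ring
  simp_rw [hl]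
  rw [Finset.sum_sub_distrib, ← Finset.sum_mul, hrs]
  simp [inner_sum, inner_smul_right]

lemma PX_shift {s m : ℕ} (X : Fin m → Euc s) (w : Euc s) (c : ℝ)
    (hη : ∀ j, ⟪w, X j⟫ = c) (v : Euc s) (t : ℝ) :
    PX X (v + t • w) = Real.exp (-(t * c)) * PX X v := by
  unfold PX
  rw [Finset.mul_sum]
  refine Finset.sum_congr rfl fun j _ => ?_
  rw [← Real.exp_add, inner_add_left, real_inner_smul_left, hη]
  congr 1; ring

lemma PX_pos {s m : ℕ} (hm : 2 ≤ m) (X : Fin m → Euc s) (v : Euc s) : 0 < PX X v :=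
  Finset.sum_pos (fun _ _ => Real.exp_pos _) ⟨⟨0, by omega⟩, Finset.mem_univ _⟩

lemma same_level {s m m' : ℕ} (hm' : 2 ≤ m')
    (X : Fin m → Euc s) (Y : Fin m' → Euc s)
    (hintX : IntegralVecs X) (hintY : IntegralVecs Y)
    (η : Euc s) (hηX : ∀ j, ⟪η, X j⟫ = 1)
    (η' : Euc s) (hηY : ∀ j, ⟪η', Y j⟫ = 1)
    (hcone : coneOf X = coneOf Y)
    (γ : Euc s → ℝ)
    (hγX : ∀ θ ∈ coneOf X, ‖θ‖ = 1 →
      Filter.Tendsto (fun k : ℕ => Real.log (multC X ((k : ℝ) • θ)) / k)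
        Filter.atTop (nhds (γ θ)))
    (hγY : ∀ θ ∈ coneOf Y, ‖θ‖ = 1 →
      Filter.Tendsto (fun k : ℕ => Real.log (multC Y ((k : ℝ) • θ)) / k)
        Filter.atTop (nhds (γ θ)))
    (v : Euc s) (hv : PX X v = 1) : PX Y v = 1 := by
  have hpos := PX_pos hm' Y v
  set t := Real.log (PX Y v) with ht
  have hv' : PX Y (v + t • η') = 1 := by
    rw [PX_shift Y η' 1 hηY, mul_one, Real.exp_neg, ht, Real.exp_log hpos,
      inv_mul_cancel₀ hpos.ne']
  have hin : ∀ θ : Euc s, ⟪v + t • η', θ⟫ = ⟪v, θ⟫ + t * ⟪η', θ⟫ := fun θ => by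
    rw [inner_add_left, real_inner_smul_left]
  have hne : ∀ θ : Euc s, ‖θ‖ = 1 → θ ≠ 0 := by
    rintro θ h rfl; simp at h
  rcases lt_trichotomy (PX Y v) 1 with h | h | h
  · exfalso
    have htn : t < 0 := Real.log_neg hpos h
    obtain ⟨θ, hθ, hθ1, hle⟩ := gamma_at X hintX η hηX v hv γ hγX
    rw [hcone] at hθ
    have h2 := gamma_le Y hintY η' hηY _ hv'.le θ hθ _ (hγY θ hθ hθ1)
    rw [hin] at h2
    have := cone_pos Y η' hηY θ hθ (hne θ hθ1)
    nlinarith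
  · exact h
  · exfalso
    have htn : 0 < t := Real.log_pos h
    obtain ⟨θ, hθ, hθ1, hle⟩ := gamma_at Y hintY η' hηY _ hv' γ hγY
    have := cone_pos Y η' hηY θ hθ (hne θ hθ1)
    rw [← hcone] at hθ
    have h2 := gamma_le X hintX η hηX _ hv.le θ hθ _ (hγX θ hθ hθ1)
    rw [hin] at hle
    nlinarith

lemma eta_rat {s m : ℕ} (X : Fin m → Euc s) (hint : IntegralVecs X)
    (hspan : Submodule.span ℝ (Set.range X) = ⊤)
    (η : Euc s) (hη : ∀ j, ⟪η, X j⟫ = 1) (i : Fin s) : ∃ q : ℚ, η i = (q : ℝ) := by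
  choose f hf using hint
  let A : Matrix (Fin m) (Fin s) ℚ := Matrix.of fun j i => (f j i : ℚ)
  let φ : ℚ →+* ℝ := algebraMap ℚ ℝ
  let Ar : Matrix (Fin m) (Fin s) ℝ := A.map φ
  have hAr : ∀ w : Euc s, ∀ j, (Ar.mulVec w.ofLp) j = ⟪w, X j⟫ := by
    intro w j
    simp only [Ar, A, Matrix.mulVec, dotProduct, PiLp.inner_apply, φ]
    refine Finset.sum_congr rfl fun i _ => ?_
    simp [hf]
  let G : Matrix (Fin s) (Fin s) ℚ := A.transpose * A
  let Gr : Matrix (Fin s) (Fin s) ℝ := Ar.transpose * Ar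
  have hG : G.map φ = Gr := by
    simp only [G, Gr, Ar, Matrix.map_mul, Matrix.transpose_map]
  have hdet : Gr.det ≠ 0 := by
    intro h
    obtain ⟨w, hw0, hw⟩ := Matrix.exists_mulVec_eq_zero_iff.2 h
    have h1 : Ar.mulVec w ⬝ᵥ Ar.mulVec w = 0 := by
      have : w ⬝ᵥ Gr.mulVec w = 0 := by rw [hw]; simp
      rw [← Matrix.mulVec_mulVec, Matrix.dotProduct_mulVec, Matrix.vecMul_transpose] at this
      exact this
    rw [dotProduct_self_eq_zero] at h1
    have h2 : ∀ j, ⟪(WithLp.toLp 2 w : Euc s), X j⟫ = 0 := by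
      intro j
      rw [← hAr]
      exact congrFun h1 j
    have h3 : ∀ x ∈ Submodule.span ℝ (Set.range X), ⟪(WithLp.toLp 2 w : Euc s), x⟫ = 0 := by
      intro x hx
      induction hx using Submodule.span_induction with
      | mem x hx => obtain ⟨j, rfl⟩ := hx; exact h2 j
      | zero => simp
      | add x y _ _ h1 h2 => rw [inner_add_right, h1, h2, add_zero]
      | smul a x _ h => rw [inner_smul_right, h, mul_zero]
    rw [hspan] at h3
    have h4 := h3 _ (Submodule.mem_top (x := (WithLp.toLp 2 w : Euc s)))
    rw [inner_self_eq_zero] at h4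
    apply hw0
    simpa using h4
  have h1 : Ar.mulVec η.ofLp = fun _ => 1 := by
    funext j; rw [hAr, hη]
  have h2 : Gr.det • η.ofLp = Gr.adjugate.mulVec (Ar.transpose.mulVec (fun _ => 1)) := by
    rw [← h1, Matrix.mulVec_mulVec, Matrix.mulVec_mulVec, Matrix.mul_assoc]
    change _ = (Gr.adjugate * Gr).mulVec _
    rw [Matrix.adjugate_mul, Matrix.smul_mulVec, Matrix.one_mulVec]
  have h3 : φ G.det = Gr.det := by rw [RingHom.map_det, ← hG]; rfl
  have h4 : Gr.adjugate = G.adjugate.map φ := by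
    rw [← hG]
    exact (RingHom.map_adjugate φ G).symm
  refine ⟨G.adjugate.mulVec (A.transpose.mulVec (fun _ => 1)) i / G.det, ?_⟩
  have h5 := congrFun h2 i
  rw [h4, ← h3] at h5
  have h6 : φ G.det ≠ 0 := by rw [h3]; exact hdet
  have h7 : ((G.adjugate.map φ).mulVec (Ar.transpose.mulVec fun _ => 1)) i
      = φ (G.adjugate.mulVec (A.transpose.mulVec (fun _ => 1)) i) := by
    rw [RingHom.map_mulVec, Function.comp_def]
    congr 2
    funext k
    rw [RingHom.map_mulVec]
    simp [Ar, Function.comp_def, Matrix.transpose_map]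
  rw [h7] at h5
  rw [Rat.cast_div]
  change η.ofLp i = φ _ / φ _
  rw [eq_div_iff h6, ← h5]
  simp [mul_comm]

lemma inner_rat {s m : ℕ} (X : Fin m → Euc s) (hint : IntegralVecs X) (η : Euc s)
    (hη : ∀ i, ∃ q : ℚ, η i = (q : ℝ)) (j : Fin m) : ∃ q : ℚ, ⟪η, X j⟫ = (q : ℝ) := by
  choose q hq using hη
  choose f hf using hint
  refine ⟨∑ i, q i * f j i, ?_⟩
  simp [PiLp.inner_apply, hq, hf, mul_comm]

lemma common_den {m : ℕ} (a : Fin m → ℝ) (hq : ∀ j, ∃ q : ℚ, a j = (q : ℝ))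
    (hpos : ∀ j, 0 < a j) :
    ∃ N : ℕ, 0 < N ∧ ∃ α : Fin m → ℕ, ∀ j, 0 < α j ∧ a j * N = α j := by
  choose q hq using hq
  refine ⟨∏ j, (q j).den, Finset.prod_pos fun j _ => (q j).den_pos, ?_⟩
  have : ∀ j, ∃ n : ℕ, 0 < n ∧ a j * (∏ j, (q j).den : ℕ) = n := by
    intro j
    obtain ⟨d, hd⟩ := Finset.dvd_prod_of_mem (fun j => (q j).den) (Finset.mem_univ j)
    have hN : 0 < ∏ j, (q j).den := Finset.prod_pos fun j _ => (q j).den_pos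
    have hqpos : 0 < q j := by
      have := hpos j; rw [hq j] at this; exact_mod_cast this
    have hnum : 0 < (q j).num := Rat.num_pos.2 hqpos
    have hd0 : 0 < d := by
      rcases Nat.eq_zero_or_pos d with h | h
      · rw [hd, h] at hN; simp at hN
      · exact h
    refine ⟨(q j).num.toNat * d, Nat.mul_pos (by omega) hd0, ?_⟩
    rw [hd, hq j]
    have h1 : ((q j).num.toNat : ℝ) = ((q j).num : ℝ) := by
      have : (((q j).num.toNat : ℤ) : ℝ) = ((q j).num : ℝ) := by
        rw [Int.toNat_of_nonneg hnum.le]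
      exact_mod_cast this
    have h2 : (q j : ℝ) * (q j).den = (q j).num := by
      exact_mod_cast Rat.mul_den_eq_num (q j)
    push_cast
    rw [h1, ← h2]; ring
  choose α hα using this
  exact ⟨α, hα⟩

open Polynomial in
lemma alg_key (p E : ℂ[X]) (y : {x : ℝ // 0 < x} → ℂ) (N M B : ℕ) (hM : M ≠ 0) (hB : B ≠ 0)
    (hE : E.eval 0 ≠ 0) (h1 : ∀ x, y x ^ M = p.eval ((x : ℝ) : ℂ))
    (h2 : ∀ x : {x : ℝ // 0 < x}, ((x : ℝ) : ℂ) ^ N * E.eval (y x) = y x ^ B) (x0 : ℂ) (hx0 : p.eval x0 = 0) :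
    x0 = 0 := by
  let φ : ℂ[X] →+* ({x : ℝ // 0 < x} → ℂ) :=
    RingHom.pi fun x => Polynomial.evalRingHom ((x : ℝ) : ℂ)
  let _ : Algebra ℂ[X] ({x : ℝ // 0 < x} → ℂ) := φ.toAlgebra
  have hφ : ∀ q x, algebraMap ℂ[X] ({x : ℝ // 0 < x} → ℂ) q x = q.eval ((x : ℝ) : ℂ) :=
    fun q x => rfl
  have hinj : Function.Injective (algebraMap ℂ[X] ({x : ℝ // 0 < x} → ℂ)) := by
    rw [injective_iff_map_eq_zero]
    intro q hq
    apply Polynomial.eq_zero_of_infinite_isRoot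
    have hinf : (Set.Ioi (0 : ℝ)).Infinite := Set.Ioi_infinite 0
    refine (hinf.image (f := fun x : ℝ => (x : ℂ)) (Complex.ofReal_injective.injOn)).mono ?_
    rintro _ ⟨x, hx, rfl⟩
    have := congrFun hq ⟨x, hx⟩
    rw [hφ] at this
    exact this
  have hyint : IsIntegral ℂ[X] y := by
    refine ⟨X ^ M - C p, monic_X_pow_sub_C p hM, ?_⟩
    funext x
    simp [eval₂_sub, hφ, h1]
  let S := Algebra.adjoin ℂ[X] ({y} : Set ({x : ℝ // 0 < x} → ℂ))
  have : Algebra.IsIntegral ℂ[X] S :=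
    Algebra.IsIntegral.adjoin (by rintro z rfl; exact hyint)
  let P := RingHom.ker (Polynomial.evalRingHom x0)
  have : P.IsPrime := RingHom.ker_isPrime _
  have hker : Ideal.comap (algebraMap ℂ[X] S) ⊥ ≤ P := by
    intro q hq
    have hq' : algebraMap ℂ[X] S q = 0 :=
      Ideal.mem_bot.1 (Ideal.mem_comap.1 hq)
    have : algebraMap ℂ[X] ({x : ℝ // 0 < x} → ℂ) q = 0 := by
      rw [IsScalarTower.algebraMap_apply ℂ[X] S, hq', map_zero]
    rw [(injective_iff_map_eq_zero _).1 hinj q this]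
    exact P.zero_mem
  obtain ⟨Q, -, hQ, hQP⟩ := Ideal.exists_ideal_over_prime_of_isIntegral P (⊥ : Ideal S) hker
  let Y : S := ⟨y, Algebra.subset_adjoin rfl⟩
  have hmem : ∀ q : ℂ[X], algebraMap ℂ[X] S q ∈ Q ↔ q.eval x0 = 0 := by
    intro q
    rw [← Ideal.mem_comap, hQP]
    simp [P, RingHom.mem_ker]
  have hYM : Y ^ M = algebraMap ℂ[X] S p := by
    apply Subtype.ext
    funext x
    exact h1 x
  have hYQ : Y ∈ Q := by
    apply hQ.mem_of_pow_mem M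
    rw [hYM, hmem]
    exact hx0
  let ι : ℂ →+* S := (algebraMap ℂ[X] S).comp C
  have hrel : algebraMap ℂ[X] S X ^ N * E.eval₂ ι Y = Y ^ B := by
    apply Subtype.ext
    funext x
    have e1 : ((E.eval₂ ι Y : S) : {x : ℝ // 0 < x} → ℂ) x = E.eval (y x) := by
      let ψ : S →+* ℂ := (Pi.evalRingHom _ x).comp S.val.toRingHom
      change ψ (E.eval₂ ι Y) = _
      rw [Polynomial.hom_eval₂]
      have : ψ.comp ι = RingHom.id ℂ := by
        ext c
        change (C c).eval _ = c
        simp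
      rw [this]
      rfl
    have := h2 x
    rw [← e1] at this
    change (X : ℂ[X]).eval ((x : ℝ) : ℂ) ^ N * _ = y x ^ B
    rw [eval_X]
    exact this
  have hEdiff : E.eval₂ ι Y - ι (E.eval 0) ∈ Q := by
    have h3 : E = E.divX * X + C (E.coeff 0) := (divX_mul_X_add E).symm
    have h4 : E.eval₂ ι Y = E.divX.eval₂ ι Y * Y + ι (E.coeff 0) := by
      conv_lhs => rw [h3]
      rw [eval₂_add, eval₂_C, eval₂_mul, eval₂_X]
    rw [h4, ← coeff_zero_eq_eval_zero, add_sub_cancel_right]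
    exact Q.mul_mem_left _ hYQ
  have hprod : algebraMap ℂ[X] S X ^ N * E.eval₂ ι Y ∈ Q := by
    rw [hrel]; exact Q.pow_mem_of_mem hYQ B (Nat.pos_of_ne_zero hB)
  rcases hQ.mem_or_mem hprod with h | h
  · have := hQ.mem_of_pow_mem N h
    rw [hmem] at this
    simpa using this
  · exfalso
    have h5 := Q.sub_mem h hEdiff
    rw [sub_sub_cancel] at h5
    have := (hmem _).1 h5
    simp at this
    exact hE this
open Polynomial in
lemma alpha_const {m : ℕ} (α : Fin m → ℕ)
    (h : ∀ x0 : ℂ, (∑ j, (X : ℂ[X]) ^ α j).eval x0 = 0 → x0 = 0) (i j : Fin m) :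
    α i = α j := by
  classical
  have : Nonempty (Fin m) := ⟨i⟩
  obtain ⟨j0, hj0⟩ := Finite.exists_min α
  have hsum : ∀ (f : Fin m → ℕ) (n : ℕ) (k : Fin m), f k = n →
      (∑ j, (X : ℂ[X]) ^ f j).coeff n ≠ 0 := by
    intro f n k hk
    rw [finsetSum_coeff]
    simp only [coeff_X_pow, Finset.sum_boole]
    have : 0 < (Finset.univ.filter (fun i => n = f i)).card :=
      Finset.card_pos.2 ⟨k, by simp [hk]⟩
    exact_mod_cast this.ne'
  set q : ℂ[X] := ∑ j, X ^ (α j - α j0) with hq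
  have hpq : ∑ j, (X : ℂ[X]) ^ α j = X ^ α j0 * q := by
    rw [hq, Finset.mul_sum]
    refine Finset.sum_congr rfl fun k _ => ?_
    rw [← pow_add, Nat.add_sub_cancel' (hj0 k)]
  have hq0 : q.eval 0 ≠ 0 := by
    rw [← coeff_zero_eq_eval_zero]
    exact hsum _ 0 j0 (by simp)
  have hdeg : q.degree = 0 := by
    by_contra hd
    obtain ⟨x0, hx0⟩ := IsAlgClosed.exists_root q hd
    have h0 : x0 = 0 := h x0 (by rw [hpq, eval_mul, hx0.eq_zero, mul_zero])
    subst h0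
    exact hq0 hx0
  have hmin : ∀ k, α k = α j0 := by
    intro k
    by_contra hk
    have h1 : α k - α j0 ≠ 0 := by have := hj0 k; omega
    have h2 := hsum (fun j => α j - α j0) (α k - α j0) k rfl
    apply h2
    apply coeff_eq_zero_of_degree_lt
    change q.degree < _
    rw [hdeg]
    exact_mod_cast Nat.pos_of_ne_zero h1
  rw [hmin i, hmin j]

open Polynomial in
lemma proportional {s m m' : ℕ} (hm : 2 ≤ m) (hm' : 2 ≤ m')
    (Xv : Fin m → Euc s) (Yv : Fin m' → Euc s)
    (η : Euc s) (hηX : ∀ j, ⟪η, Xv j⟫ = 1)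
    (η' : Euc s) (hηY : ∀ j, ⟪η', Yv j⟫ = 1)
    (N : ℕ) (hN : 0 < N) (α : Fin m → ℕ) (hα : ∀ j, 0 < α j ∧ ⟪η', Xv j⟫ * N = α j)
    (M : ℕ) (hM : 0 < M) (β : Fin m' → ℕ) (hβ : ∀ j, 0 < β j ∧ ⟪η, Yv j⟫ * M = β j)
    (H : ∀ v, PX Xv v = 1 → PX Yv v = 1) (i j : Fin m) : α i = α j := by
  have : Nonempty (Fin m') := ⟨⟨0, by omega⟩⟩
  obtain ⟨j0, hj0⟩ := Finite.exists_max β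
  have hN' : (0 : ℝ) < N := by exact_mod_cast hN
  have hM' : (0 : ℝ) < M := by exact_mod_cast hM
  set Z : ℝ → ℝ := fun x => ∑ j, x ^ α j with hZ
  have hZpos : ∀ x, 0 < x → 0 < Z x := fun x hx =>
    Finset.sum_pos (fun _ _ => pow_pos hx _) ⟨⟨0, by omega⟩, Finset.mem_univ _⟩
  set yr : ℝ → ℝ := fun x => Real.exp (Real.log (Z x) / M) with hyr
  have hyM : ∀ x, 0 < x → yr x ^ M = Z x := by
    intro x hx
    rw [hyr]
    simp only
    rw [← Real.exp_nat_mul, mul_div_cancel₀ _ hM'.ne', Real.exp_log (hZpos x hx)]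
  have hrel : ∀ x, 0 < x → x ^ N * ∑ j, yr x ^ (β j0 - β j) = yr x ^ β j0 := by
    intro x hx
    have hz := hZpos x hx
    set t := Real.log (Z x) with ht
    have h1 : PX Xv ((-(N * Real.log x)) • η' + t • η) = 1 := by
      rw [PX_shift Xv η 1 hηX, mul_one]
      have h2 : PX Xv ((-(N * Real.log x)) • η') = Z x := by
        unfold PX
        refine Finset.sum_congr rfl fun j _ => ?_
        rw [real_inner_smul_left, ← Real.exp_log (pow_pos hx (α j)), Real.log_pow, ← (hα j).2]
        congr 1; ring
      rw [h2, Real.exp_neg, ht, Real.exp_log hz, inv_mul_cancel₀ hz.ne']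
    have h3 := H _ h1
    rw [add_comm, PX_shift Yv η' 1 hηY, mul_one, neg_neg, ← Real.log_pow,
      Real.exp_log (pow_pos hx N)] at h3
    have hy : 0 < yr x := Real.exp_pos _
    have h4 : PX Yv (t • η) = ∑ j, (yr x ^ β j)⁻¹ := by
      unfold PX
      refine Finset.sum_congr rfl fun j _ => ?_
      rw [real_inner_smul_left, Real.exp_neg, hyr]
      simp only
      rw [← Real.exp_nat_mul, ← (hβ j).2]
      congr 2
      field_simp
      rw [ht, mul_comm]
    rw [h4] at h3
    have h5 : ∑ j, yr x ^ (β j0 - β j) = yr x ^ β j0 * ∑ j, (yr x ^ β j)⁻¹ := by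
      rw [Finset.mul_sum]
      refine Finset.sum_congr rfl fun j _ => ?_
      rw [pow_sub₀ _ hy.ne' (hj0 j)]
    rw [h5]
    linear_combination (yr x ^ β j0) * h3
  refine alpha_const α (fun x0 hx0 => ?_) i j
  refine alg_key (∑ j, X ^ α j) (∑ j, X ^ (β j0 - β j)) (fun x => ((yr x : ℝ) : ℂ)) N M (β j0)
    hM.ne' (hβ j0).1.ne' ?_ ?_ ?_ x0 hx0
  · rw [← coeff_zero_eq_eval_zero, finsetSum_coeff]
    simp only [coeff_X_pow, Finset.sum_boole]
    have : 0 < (Finset.univ.filter (fun i => 0 = β j0 - β i)).card :=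
      Finset.card_pos.2 ⟨j0, by simp⟩
    exact_mod_cast this.ne'
  · intro x
    rw [eval_finsetSum]
    simp only [eval_pow, eval_X]
    have := hyM x x.2
    rw [hZ] at this
    simp only at this
    exact_mod_cast this
  · intro x
    rw [eval_finsetSum]
    simp only [eval_pow, eval_X]
    exact_mod_cast hrel x x.2

/-- The exponential character attached to `z`. -/
def chi {s : ℕ} (z : Euc s) : Multiplicative (Euc s) →* ℝ where
  toFun v := Real.exp (-⟪Multiplicative.toAdd v, z⟫)
  map_one' := by simp
  map_mul' a b := by
    rw [← Real.exp_add, toAdd_mul, inner_add_left]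
    congr 1; ring

lemma chi_inj {s : ℕ} : Function.Injective (chi (s := s)) := by
  intro z z' h
  have h1 : ∀ v : Euc s, ⟪v, z⟫ = ⟪v, z'⟫ := by
    intro v
    have := DFunLike.congr_fun h (Multiplicative.ofAdd v)
    change Real.exp (-⟪v, z⟫) = Real.exp (-⟪v, z'⟫) at this
    have := Real.exp_injective this
    linarith
  exact ext_inner_left ℝ h1

lemma equiv_of_exp {s : ℕ} {A B : Type} [Fintype A] [Fintype B] (f : A → Euc s) (g : B → Euc s)
    (h : ∀ v : Euc s, ∑ a, Real.exp (-⟪v, f a⟫) = ∑ b, Real.exp (-⟪v, g b⟫)) :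
    ∃ e : A ≃ B, ∀ a, g (e a) = f a := by
  classical
  have hli : LinearIndependent ℝ (fun z : Euc s => (chi z : Multiplicative (Euc s) → ℝ)) :=
    (linearIndependent_monoidHom (Multiplicative (Euc s)) ℝ).comp _ chi_inj
  let l : Euc s →₀ ℝ := ∑ a, Finsupp.single (f a) (1 : ℝ) - ∑ b, Finsupp.single (g b) (1 : ℝ)
  have hl : l = 0 := by
    apply linearIndependent_iff.1 hli
    simp only [l, map_sub, map_sum, Finsupp.linearCombination_single, one_smul]
    funext v
    simp only [Pi.sub_apply, Finset.sum_apply, Pi.zero_apply]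
    exact sub_eq_zero.2 (h (Multiplicative.toAdd v))
  have hcard : ∀ z, Fintype.card {a // f a = z} = Fintype.card {b // g b = z} := by
    intro z
    have h1 := DFunLike.congr_fun hl z
    simp only [l, Finsupp.sub_apply, Finsupp.finsetSum_apply, Finsupp.single_apply,
      Finset.sum_boole, Finsupp.zero_apply] at h1
    rw [Fintype.card_subtype, Fintype.card_subtype]
    exact_mod_cast sub_eq_zero.1 h1
  let e : A ≃ B := (Equiv.sigmaFiberEquiv f).symm.trans
    ((Equiv.sigmaCongrRight fun z => Fintype.equivOfCardEq (hcard z)).trans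
      (Equiv.sigmaFiberEquiv g))
  refine ⟨e, fun a => ?_⟩
  exact (Fintype.equivOfCardEq (hcard (f a)) ⟨a, rfl⟩).2

/-- Rigidity: if `X` is `η`-coplanar, `Y` is `η'`-coplanar, they generate the same
cone and define the same directional growth function, then `η = c·η'` for some
`c > 0` and some iterations `X^(n)` and `Y^(n')` are permutations of each other. -/
theorem stmt19 {s m m' : ℕ} (hs : 1 ≤ s) (hm : 2 ≤ m) (hm' : 2 ≤ m')
    (X : Fin m → Euc s) (Y : Fin m' → Euc s)
    (hintX : IntegralVecs X) (hintY : IntegralVecs Y)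
    (hspanX : Submodule.span ℝ (Set.range X) = ⊤)
    (hspanY : Submodule.span ℝ (Set.range Y) = ⊤)
    (α : Euc s) (hαX : ∀ j, 0 < ⟪X j, α⟫)
    (α' : Euc s) (hαY : ∀ j, 0 < ⟪Y j, α'⟫)
    (η : Euc s) (hηX : ∀ j, ⟪η, X j⟫ = 1)
    (η' : Euc s) (hηY : ∀ j, ⟪η', Y j⟫ = 1)
    (hcone : coneOf X = coneOf Y)
    (γ : Euc s → ℝ)
    (hγX : ∀ θ ∈ coneOf X, ‖θ‖ = 1 →
      Filter.Tendsto (fun k : ℕ => Real.log (multC X ((k : ℝ) • θ)) / k)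
        Filter.atTop (nhds (γ θ)))
    (hγY : ∀ θ ∈ coneOf Y, ‖θ‖ = 1 →
      Filter.Tendsto (fun k : ℕ => Real.log (multC Y ((k : ℝ) • θ)) / k)
        Filter.atTop (nhds (γ θ))) :
    (∃ c : ℝ, 0 < c ∧ η = c • η') ∧
    ∃ n n' : ℕ, 1 ≤ n ∧ 1 ≤ n' ∧
      ∃ e : (Fin n → Fin m) ≃ (Fin n' → Fin m'),
        ∀ ω, iter Y n' (e ω) = iter X n ω := by
  have H := same_level hm' X Y hintX hintY η hηX η' hηY hcone γ hγX hγY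
  have hX0 : ∀ j, X j ≠ 0 := by
    intro j h; have := hηX j; rw [h] at this; simp at this
  have hY0 : ∀ j, Y j ≠ 0 := by
    intro j h; have := hηY j; rw [h] at this; simp at this
  have hXc : ∀ j, X j ∈ coneOf X := fun j =>
    ⟨Pi.single j 1, fun i => by by_cases h : i = j <;> simp [Pi.single_apply, h],
      by simp [Pi.single_apply]⟩
  have hYc : ∀ j, Y j ∈ coneOf Y := fun j =>
    ⟨Pi.single j 1, fun i => by by_cases h : i = j <;> simp [Pi.single_apply, h],
      by simp [Pi.single_apply]⟩
  have ha : ∀ j, 0 < ⟪η', X j⟫ := fun j => cone_pos Y η' hηY _ (hcone ▸ hXc j) (hX0 j)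
  have hb : ∀ j, 0 < ⟪η, Y j⟫ := fun j => cone_pos X η hηX _ (hcone.symm ▸ hYc j) (hY0 j)
  obtain ⟨N, hN, a, hα⟩ := common_den (fun j => ⟪η', X j⟫)
    (inner_rat X hintX η' (eta_rat Y hintY hspanY η' hηY)) ha
  obtain ⟨M, hM, b, hβ⟩ := common_den (fun j => ⟪η, Y j⟫)
    (inner_rat Y hintY η (eta_rat X hintX hspanX η hηX)) hb
  have hconst := proportional hm hm' X Y η hηX η' hηY N hN a hα M hM b hβ H
  have hN' : (0 : ℝ) < N := by exact_mod_cast hN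
  have hM' : (0 : ℝ) < M := by exact_mod_cast hM
  let i0 : Fin m := ⟨0, by omega⟩
  let j0 : Fin m' := ⟨0, by omega⟩
  set c := ⟪η', X i0⟫ with hc
  have hc0 : 0 < c := ha i0
  have hcj : ∀ j, ⟪η', X j⟫ = c := by
    intro j
    have h1 := (hα j).2
    have h2 := (hα i0).2
    rw [hconst j i0, ← h2] at h1
    exact mul_right_cancel₀ hN'.ne' h1
  have hprop : η' = c • η := by
    have h3 : ∀ x ∈ Submodule.span ℝ (Set.range X), ⟪η' - c • η, x⟫ = 0 := by
      intro x hx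
      induction hx using Submodule.span_induction with
      | mem x hx =>
        obtain ⟨j, rfl⟩ := hx
        rw [inner_sub_left, real_inner_smul_left, hηX, hcj]; ring
      | zero => simp
      | add x y _ _ h1 h2 => rw [inner_add_right, h1, h2, add_zero]
      | smul a x _ h => rw [inner_smul_right, h, mul_zero]
    rw [hspanX] at h3
    have h4 := h3 _ (Submodule.mem_top (x := η' - c • η))
    rw [inner_self_eq_zero] at h4
    exact sub_eq_zero.1 h4
  have hprop' : η = c⁻¹ • η' := by rw [hprop, smul_smul, inv_mul_cancel₀ hc0.ne', one_smul]
  refine ⟨⟨c⁻¹, inv_pos.2 hc0, hprop'⟩, b j0, M, (hβ j0).1, hM, ?_⟩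
  have hYj : ∀ j, ⟪η, Y j⟫ = c⁻¹ := by
    intro j
    rw [hprop', real_inner_smul_left, hηY, mul_one]
  apply equiv_of_exp
  intro v
  rw [← PX_pow, ← PX_pow]
  have hpos := PX_pos hm X v
  set t := Real.log (PX X v) with ht
  have h1 : PX X (v + t • η) = 1 := by
    rw [PX_shift X η 1 hηX, mul_one, Real.exp_neg, ht, Real.exp_log hpos,
      inv_mul_cancel₀ hpos.ne']
  have h2 := H _ h1
  rw [PX_shift Y η c⁻¹ hYj, Real.exp_neg, inv_mul_eq_one₀ (Real.exp_pos _).ne'] at h2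
  rw [← h2, ← Real.exp_log hpos, ← ht, ← Real.exp_nat_mul, ← Real.exp_nat_mul]
  congr 1
  have h3 := (hβ j0).2
  rw [hYj] at h3
  rw [← h3]; ring
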